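/- arXiv:2403.18880 — 2 statements merged into one kernel-verified Lean document; each statement's English description precedes it below -/
import Mathlib

section
/- Let R be a weakly Rickart *-ring of nonzero characteristic, i.e. there exists a positive integer n such that n·x = 0 for all x ∈ R. Then R can be embedded in a Rickart *-ring: there exist a Rickart *-ring S and an injective additive, multiplicative, star-preserving map φ : R → S. -/
universe u

section WeaklyRickart

variable {R : Type u} [NonUnitalRing R] [StarRing R]

/-- `e` is a right projection of `x`. -/
def IsRightProjection (x e : R) : Prop :=
  (star e = e ∧ e * e = e) ∧ x * e = x ∧ ∀ y : R, x * y = 0 → e * y = 0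

lemma eq_zero_of_star_mul_self_eq_zero (hwR : ∀ x : R, ∃ e : R, IsRightProjection x e)
    {x : R} (hx : star x * x = 0) : x = 0 := by
  obtain ⟨e, ⟨hs, -⟩, he, hy⟩ := hwR (star x)
  have h := congrArg star he
  rw [star_mul, star_star, hs] at h
  rw [← h, hy x hx]

lemma IsRightProjection.mul_eq_self (hwR : ∀ x : R, ∃ e : R, IsRightProjection x e)
    {x e f : R} (hf : IsRightProjection x f) (he : star e = e) (hee : e * e = e)
    (hx : x * e = x) : e * f = f := by
  obtain ⟨⟨hs, hff⟩, hxf, hy⟩ := hf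
  have h : f * (f - e * f) = 0 := hy _ (by rw [mul_sub, ← mul_assoc, hx, sub_self])
  have h' : star (f - e * f) * (f - e * f) = 0 := by
    have h2 : f * e * (f - e * f) = 0 := by
      rw [mul_sub, mul_assoc f e (e * f), ← mul_assoc e e f, hee, mul_assoc, sub_self]
    rw [star_sub, star_mul, hs, he, sub_mul, h, h2, sub_zero]
  exact (sub_eq_zero.1 (eq_zero_of_star_mul_self_eq_zero hwR h')).symm

lemma exists_projection_mul_eq_self (hwR : ∀ x : R, ∃ e : R, IsRightProjection x e) (a : R) :
    ∃ e : R, star e = e ∧ e * e = e ∧ e * a = a ∧ a * e = a := by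
  obtain ⟨p, ⟨hps, hpp⟩, hap, -⟩ := hwR a
  obtain ⟨q, ⟨hqs, hqq⟩, haq, -⟩ := hwR (star a)
  obtain ⟨r, ⟨hrs, hrr⟩, hr, hry⟩ := hwR (q - q * p)
  have hrp : r * p = 0 := hry p (by rw [sub_mul, mul_assoc, hpp, sub_self])
  have hpr : p * r = 0 := by simpa [hps, hrs] using congrArg star hrp
  have hqr : q * r = q - q * p := by
    rwa [sub_mul, mul_assoc, hpr, mul_zero, sub_zero] at hr
  have hqe : q * (p + r) = q := by rw [mul_add, hqr]; abel
  have heq : (p + r) * q = q := by simpa [hps, hrs, hqs] using congrArg star hqe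
  have hqa : q * a = a := by simpa [hqs] using congrArg star haq
  refine ⟨p + r, by simp [hps, hrs], by simp [mul_add, add_mul, hpp, hrr, hrp, hpr], ?_, ?_⟩
  · rw [← hqa, ← mul_assoc, heq]
  · rw [mul_add, hap]
    nth_rewrite 2 [← hap]
    rw [mul_assoc, hpr, mul_zero, add_zero]

/-- The unitization of a weakly Rickart *-algebra over a commutative von Neumann regular ring
is a Rickart *-ring. -/
lemma Unitization.exists_annihilator_projection
    {K : Type*} [CommRing K] [StarRing K] [TrivialStar K]
    [Module K R] [IsScalarTower K R R] [SMulCommClass K R R] [StarModule K R]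
    (hwR : ∀ x : R, ∃ e : R, IsRightProjection x e)
    (hK : ∀ c : K, ∃ d : K, c * d * c = c) (x : Unitization K R) :
    ∃ e : Unitization K R, (star e = e ∧ e * e = e) ∧ ∀ y, x * y = 0 ↔ e * y = y := by
  obtain ⟨c, a⟩ := x
  obtain ⟨d, hd⟩ := hK c
  obtain ⟨e, hes, hee, hea, hae⟩ := exists_projection_mul_eq_self hwR a
  obtain ⟨f, hf⟩ := hwR (a + c • e)
  have hef : e * f = f :=
    hf.mul_eq_self hwR hes hee (by rw [add_mul, smul_mul_assoc, hee, hae])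
  obtain ⟨⟨hfs, hff⟩, hxf, hy⟩ := hf
  have hfe : f * e = f := by simpa [hfs, hes] using congrArg star hef
  have hcf : a * f + c • f = a + c • e := by rw [← hxf, add_mul, smul_mul_assoc, hef]
  obtain ⟨t, ht⟩ : ∃ t : K, t = c * d := ⟨_, rfl⟩
  have htc : c * t = c := by rw [ht]; linear_combination hd
  have htt : t * t = t := by rw [ht]; linear_combination d * hd
  let g : Unitization K R := ⟨t, f - t • e⟩
  have hgs : star g = g := by
    ext <;> simp [g, hfs, hes, star_sub, star_smul]
  have hgg : g * g = g := by
    ext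
    · simp [g, htt]
    · simp only [g, Unitization.snd_mul, mul_sub, sub_mul, smul_sub, smul_mul_assoc,
        mul_smul_comm, smul_smul, htt, hff, hef, hfe, hee]
      abel
  have hxg : (⟨c, a⟩ : Unitization K R) * g = ⟨c, a⟩ := by
    ext
    · simp [g, htc]
    · simp only [g, Unitization.snd_mul, mul_sub, smul_sub, mul_smul_comm, smul_smul, htc, hae]
      calc c • f - c • e + t • a + (a * f - t • a) = a * f + c • f - c • e := by abel
        _ = a := by rw [hcf, add_sub_cancel_right]
  have hg_mul : ∀ y, (⟨c, a⟩ : Unitization K R) * y = 0 → g * y = 0 := by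
    rintro ⟨m, b⟩ hxy
    have hcm : c * m = 0 := congrArg (fun z => z.fst) hxy
    have hab : c • b + m • a + a * b = 0 := congrArg (fun z => z.snd) hxy
    have htm : t * m = 0 := by rw [ht]; linear_combination d * hcm
    have hcb : c • b = -(m • a + a * b) := by rw [eq_neg_iff_add_eq_zero, ← add_assoc, hab]
    have hceb : c • (e * b) = c • b := by
      rw [← mul_smul_comm, hcb, mul_neg, mul_add, mul_smul_comm, hea, ← mul_assoc, hea]
    have hteb : t • (e * b) = t • b := by
      rw [ht, mul_comm, mul_smul, mul_smul, hceb]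
    have hfb : f * (b + m • e) = 0 := hy _ (by
      rw [add_mul, mul_add, mul_add, mul_smul_comm, mul_smul_comm, hae, smul_mul_assoc,
        smul_mul_assoc, hee, hceb, smul_smul, mul_comm m c, hcm, zero_smul, add_zero, ← hab]
      abel)
    rw [mul_add, mul_smul_comm, hfe] at hfb
    ext
    · simpa [g] using htm
    · simp only [g, Unitization.snd_mul, Unitization.snd_zero, smul_sub, sub_mul,
        smul_mul_assoc, smul_smul, mul_comm m t, htm, zero_smul, sub_zero, hteb]
      calc t • b + m • f + (f * b - t • b) = f * b + m • f := by abel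
        _ = 0 := hfb
  refine ⟨1 - g, ⟨by rw [star_sub, star_one, hgs], by simp [mul_sub, sub_mul, hgg]⟩,
    fun y => ⟨fun h => by rw [sub_mul, one_mul, hg_mul y h, sub_zero], fun h => ?_⟩⟩
  rw [sub_mul, one_mul, sub_eq_self] at h
  rw [← hxg, mul_assoc, h, mul_zero]

end WeaklyRickart

lemma Squarefree.zmod_exists_mul_mul_eq {n : ℕ} (hn : Squarefree n) (c : ZMod n) :
    ∃ d : ZMod n, c * d * c = c := by
  have : NeZero n := ⟨hn.ne_zero⟩
  have : IsReduced (ZMod n) := isReduced_zmod.2 (Or.inl hn)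
  obtain ⟨i, j, hij, h⟩ : ∃ i j : ℕ, i < j ∧ c ^ i = c ^ j := by
    obtain ⟨i, j, hne, h⟩ := Finite.exists_ne_map_eq_of_infinite (fun k : ℕ => c ^ k)
    rcases hne.lt_or_gt with hlt | hlt
    exacts [⟨i, j, hlt, h⟩, ⟨j, i, hlt, h.symm⟩]
  obtain ⟨m, rfl⟩ := Nat.exists_eq_add_of_lt hij
  refine ⟨c ^ m, sub_eq_zero.1 (pow_eq_zero_iff (n := i + 1) (by omega) |>.1 ?_)⟩
  have h0 : c ^ i * (c ^ (m + 1) - 1) = 0 := by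
    rw [mul_sub, ← pow_add, mul_one, sub_eq_zero, ← add_assoc, ← h]
  calc (c * c ^ m * c - c) ^ (i + 1)
      = c * (c ^ i * (c ^ (m + 1) - 1)) * (c ^ (m + 1) - 1) ^ i := by
        rw [show c * c ^ m * c - c = c * (c ^ (m + 1) - 1) by ring, mul_pow]; ring
    _ = 0 := by rw [h0]; ring

lemma exists_squarefree_nsmul_eq_zero {R : Type u} [NonUnitalRing R] [StarRing R]
    (hwR : ∀ x : R, ∃ e : R, IsRightProjection x e)
    (hchar : ∃ n : ℕ, 0 < n ∧ ∀ x : R, n • x = 0) :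
    ∃ n : ℕ, Squarefree n ∧ ∀ x : R, n • x = 0 := by
  classical
  obtain ⟨hpos, hn⟩ := Nat.find_spec hchar
  refine ⟨Nat.find hchar, ?_, hn⟩
  rintro d ⟨k, hk⟩
  have hdk : 0 < d * k := by
    rw [hk] at hpos
    exact Nat.pos_of_mul_pos_left (a := d) (by rwa [mul_assoc] at hpos)
  have hle : Nat.find hchar ≤ d * k := Nat.find_min' hchar ⟨hdk, fun x =>
    eq_zero_of_star_mul_self_eq_zero hwR (by
      rw [star_nsmul, smul_mul_smul_comm, show d * k * (d * k) = k * (d * d * k) by ring,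
        ← hk, mul_smul, hn, smul_zero])⟩
  rw [hk, mul_assoc] at hle
  exact Nat.isUnit_iff.2 (by nlinarith [Nat.pos_of_mul_pos_right hdk])

/-- Thakare–Waphare: a weakly Rickart *-ring of nonzero characteristic can be embedded
in a Rickart *-ring. -/
theorem weakly_rickart_embeds_of_char_ne_zero {R : Type u} [NonUnitalRing R] [StarRing R]
    (hwR : ∀ x : R, ∃ e : R, (star e = e ∧ e * e = e) ∧ x * e = x ∧
      ∀ y : R, x * y = 0 → e * y = 0)
    (hchar : ∃ n : ℕ, 0 < n ∧ ∀ x : R, n • x = 0) :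
    ∃ (S : Type u) (_ : NonUnitalRing S) (_ : StarRing S),
      (∀ x : S, ∃ e : S, (star e = e ∧ e * e = e) ∧ ∀ y : S, x * y = 0 ↔ e * y = y) ∧
      ∃ φ : R → S, Function.Injective φ ∧
        (∀ x y : R, φ (x + y) = φ x + φ y) ∧
        (∀ x y : R, φ (x * y) = φ x * φ y) ∧
        (∀ x : R, φ (star x) = star (φ x)) := by
  obtain ⟨n, hsq, hn⟩ := exists_squarefree_nsmul_eq_zero hwR hchar
  let _ : Module (ZMod n) R := AddCommGroup.zmodModule hn
  let _ : StarRing (ZMod n) := starRingOfComm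
  have : TrivialStar (ZMod n) := ⟨fun _ => rfl⟩
  have key (c : ZMod n) : ∃ k : ℤ, ∀ x : R, c • x = k • x := by
    obtain ⟨k, rfl⟩ := ZMod.intCast_surjective c
    exact ⟨k, fun x => Int.cast_smul_eq_zsmul _ k x⟩
  have : IsScalarTower (ZMod n) R R := ⟨fun c x y => by
    obtain ⟨k, hk⟩ := key c
    simp only [hk, smul_eq_mul, smul_mul_assoc]⟩
  have : SMulCommClass (ZMod n) R R := ⟨fun c x y => by
    obtain ⟨k, hk⟩ := key c
    simp only [hk, smul_eq_mul, mul_smul_comm]⟩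
  have : StarModule (ZMod n) R := ⟨fun c x => by
    obtain ⟨k, hk⟩ := key c
    rw [star_trivial c, hk, hk, star_zsmul]⟩
  exact ⟨Unitization (ZMod n) R, inferInstance, inferInstance,
    Unitization.exists_annihilator_projection hwR hsq.zmod_exists_mul_mul_eq,
    Unitization.inr, Unitization.inr_injective, Unitization.inr_add _, Unitization.inr_mul _,
    Unitization.inr_star⟩
end

section
/- Let R be a weakly p.q.-Baer *-ring and K a commutative *-ring with unity such that R is a *-algebra over K satisfying condition (β): for every λ ∈ K with λ ≠ 0 there exists a projection e_λ ∈ R such that for every x ∈ R with λx = 0, the central cover C(x) satisfies C(x)e_λ = C(x). Then R can be embedded in a p.q.-Baer *-ring with preservation of central covers: there exist a p.q.-Baer *-ring S and an injective additive, multiplicative, star-preserving map φ : R → S such that whenever e is the central cover of a in R, φ(e) is the central cover of φ(a) in S (φ(e) is a central projection of S, φ(e)φ(a) = φ(a), and φ(e) ≤ h for every central projection h of S with hφ(a) = φ(a)). -/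
universe u v

/-- `e` is the central cover of `x`: `e` is the smallest central projection with `ex = x`. -/
def IsCentralCover {R : Type*} [NonUnitalRing R] [StarRing R] (e x : R) : Prop :=
  ((star e = e ∧ e * e = e) ∧ (∀ r : R, e * r = r * e)) ∧ e * x = x ∧
    ∀ f : R, ((star f = f ∧ f * f = f) ∧ (∀ r : R, f * r = r * f)) → f * x = x → e * f = e

section CentralCover

variable {R : Type*} [NonUnitalRing R] [StarRing R]

lemma IsCentralCover.unique {e f x : R} (he : IsCentralCover e x) (hf : IsCentralCover f x) :
    e = f := by
  rw [← he.2.2 f hf.1 hf.2.1, he.1.2 f, hf.2.2 e he.1 he.2.1]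

/-- In a weakly p.q.-Baer *-ring, only `0` is annihilated by the whole ring from the left. -/
lemma eq_zero_of_forall_mul_eq_zero
    (hw : ∀ x : R, ∃ e : R, IsCentralCover e x ∧
      ∀ y : R, (∀ r : R, x * r * y = 0) ↔ e * y = 0)
    {t : R} (ht : ∀ r : R, r * t = 0) : t = 0 := by
  obtain ⟨e, he, h⟩ := hw t
  rw [← he.2.1]
  exact (h t).1 fun r => ht (t * r)

/-- In a weakly p.q.-Baer *-ring, only `0` annihilates the whole ring from the left. -/
lemma eq_zero_of_forall_mul_eq_zero'
    (hw : ∀ x : R, ∃ e : R, IsCentralCover e x ∧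
      ∀ y : R, (∀ r : R, x * r * y = 0) ↔ e * y = 0)
    {t : R} (ht : ∀ r : R, t * r = 0) : t = 0 := by
  obtain ⟨e, he, h⟩ := hw t
  rw [← he.2.1]
  exact (h t).1 fun r => by rw [ht r, zero_mul]

/-- Two central projections have an upper bound among the central projections, which moreover
fixes everything fixed by one of them. -/
lemma exists_central_projection_ge {p q : R}
    (hp : (star p = p ∧ p * p = p) ∧ ∀ r : R, p * r = r * p)
    (hq : (star q = q ∧ q * q = q) ∧ ∀ r : R, q * r = r * q) :
    ∃ g : R, ((star g = g ∧ g * g = g) ∧ ∀ r : R, g * r = r * g) ∧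
      (∀ x, p * x = x → g * x = x) ∧ ∀ x, q * x = x → g * x = x := by
  obtain ⟨⟨hp1, hp2⟩, hp3⟩ := hp
  obtain ⟨⟨hq1, hq2⟩, hq3⟩ := hq
  have hpx : ∀ x, p * x = x → (p + q - p * q) * x = x := fun x hx => by
    rw [hp3 q, sub_mul, add_mul, mul_assoc, hx, add_sub_cancel_right]
  have hqx : ∀ x, q * x = x → (p + q - p * q) * x = x := fun x hx => by
    rw [sub_mul, add_mul, mul_assoc, hx, add_sub_cancel_left]
  refine ⟨p + q - p * q, ⟨⟨?_, ?_⟩, fun r => ?_⟩, hpx, hqx⟩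
  · rw [star_sub, star_add, star_mul, hp1, hq1, hp3 q]
  · have h : p * (p * q) = p * q := by rw [← mul_assoc, hp2]
    rw [mul_sub, mul_add, hpx p hp2, hqx q hq2, hpx _ h]
  · rw [sub_mul, mul_sub, add_mul, mul_add, hp3 r, hq3 r, mul_assoc, hq3 r, ← mul_assoc, hp3 r,
      mul_assoc]

end CentralCover

/-- The projection required for a right annihilator in an extension `S` of a weakly p.q.-Baer
*-ring `R` in which `R` is a faithful ideal and every element is a scalar plus an element of `R`. -/
lemma exists_projection_annihilator {R K S : Type*}
    [NonUnitalRing R] [StarRing R] [CommRing K]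
    [Module K R] [IsScalarTower K R R] [SMulCommClass K R R] [Ring S] [StarRing S]
    (hw : ∀ x : R, ∃ e : R, IsCentralCover e x ∧
      ∀ y : R, (∀ r : R, x * r * y = 0) ↔ e * y = 0)
    (hβ : ∀ l : K, l ≠ 0 → ∃ el : R, (star el = el ∧ el * el = el) ∧
      ∀ x : R, l • x = 0 → ∀ c : R, IsCentralCover c x → c * el = c)
    (φ : R →⋆ₙ+* S) (k : K →+* S) (hφ : Function.Injective φ)
    (hk : ∀ l x, k l * φ x = φ (l • x))
    (hideal : ∀ (y : S) (s : R), ∃ t, y * φ s = φ t)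
    (hfaith : ∀ y : S, (∀ s, y * φ s = 0) → y = 0)
    (hcentral : ∀ e : R, (∀ r, e * r = r * e) → ∀ s, φ e * s = s * φ e)
    (hcover : ∀ x e : R, IsCentralCover e x → ∀ y : S,
      (∀ r, φ x * φ r * y = 0) → φ e * y = 0)
    (x : R) (l : K) :
    ∃ e : S, (star e = e ∧ e * e = e) ∧
      ∀ y : S, (∀ r : S, (φ x + k l) * r * y = 0) ↔ e * y = y := by
  obtain ⟨q, hq, -⟩ := hw x
  by_cases hl : l = 0
  · subst hl
    have hqq : φ q * φ q = φ q := by rw [← map_mul, hq.1.1.2]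
    refine ⟨1 - φ q, ⟨?_, ?_⟩, fun y => ?_⟩
    · rw [star_sub, star_one, ← map_star, hq.1.1.1]
    · rw [mul_sub, sub_mul, sub_mul, hqq]; simp
    · rw [map_zero, add_zero, sub_mul, one_mul, sub_eq_self]
      refine ⟨fun h => hcover x q hq y fun r => h (φ r), fun h r => ?_⟩
      rw [← hq.2.1, map_mul, hcentral q hq.1.2, mul_assoc, mul_assoc, ← mul_assoc (φ q),
        hcentral q hq.1.2, mul_assoc, h, mul_zero, mul_zero]
  obtain ⟨el, -, hel⟩ := hβ l hl
  obtain ⟨p, hp, -⟩ := hw el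
  obtain ⟨g, ⟨⟨hg1, hg2⟩, hg3⟩, hpg, hqg⟩ := exists_central_projection_ge hp.1 hq.1
  have hgx : g * x = x := hqg x hq.2.1
  have hxg : x * g = x := by rw [← hg3, hgx]
  have hinj : ∀ u : R, l • u = 0 → g * u = 0 → u = 0 := fun u hu hgu => by
    obtain ⟨c, hc, -⟩ := hw u
    have hcel := hel u hu c hc
    have hgc : g * c = c := by
      refine hpg c ?_
      rw [← hcel, ← mul_assoc, hp.1.2 c, mul_assoc, hp.2.1]
    rw [← hc.2.1, ← hgc, hg3, mul_assoc, hgu, mul_zero]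
  obtain ⟨h, hh, -⟩ := hw (x + l • g)
  have hgz : g * (x + l • g) = x + l • g := by rw [mul_add, hgx, mul_smul_comm, hg2]
  have hhg : h * g = h := hh.2.2 g ⟨⟨hg1, hg2⟩, hg3⟩ hgz
  have hgh : g * h = h := by rw [hg3, hhg]
  have hag : (φ x + k l) * φ g = φ (x + l • g) := by
    rw [add_mul, hk, ← map_mul, hxg, map_add]
  refine ⟨φ (g - h), ⟨?_, ?_⟩, fun y => ⟨fun hy => ?_, fun hy r => ?_⟩⟩
  · rw [← map_star, star_sub, hg1, hh.1.1.1]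
  · rw [← map_mul, mul_sub, sub_mul, sub_mul, hg2, hhg, hgh, hh.1.1.2, sub_self, sub_zero]
  · have hhy : φ h * y = 0 := hcover _ h hh y fun r => by
      rw [← hag, mul_assoc (_ + _)]
      exact hy _
    have hgy : φ g * y - y = 0 := hfaith _ fun s => by
      obtain ⟨t, ht⟩ := hideal y s
      rw [sub_mul, mul_assoc, ht, ← map_mul, ← map_sub]
      suffices g * t - t = 0 by rw [this, map_zero]
      refine eq_zero_of_forall_mul_eq_zero hw fun r => ?_
      have hrt : r * (g * t - t) = g * (r * t) - r * t := by
        rw [mul_sub, ← mul_assoc r g, ← hg3, mul_assoc]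
      rw [hrt]
      refine hinj _ (hφ ?_) ?_
      · have h1 : (φ x + k l) * φ (g * r - r) * (y * φ s) = 0 := by
          rw [← mul_assoc, hy, zero_mul]
        have h2 : x * (g * r - r) = 0 := by
          rw [mul_sub, ← mul_assoc, hxg, sub_self]
        rw [ht, add_mul, ← map_mul, h2, map_zero, zero_add, hk, ← map_mul] at h1
        rw [map_zero, ← h1, smul_mul_assoc, sub_mul, mul_assoc]
      · rw [mul_sub, ← mul_assoc, hg2, sub_self]
    rw [map_sub, sub_mul, hhy, sub_zero, sub_eq_zero.1 hgy]
  · have hz : (φ x + k l) * φ (g - h) = 0 := by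
      have h1 : φ (g - h) = φ g * φ (g - h) := by rw [← map_mul, mul_sub, hg2, hgh]
      have h2 : (x + l • g) * (g - h) = 0 := by
        rw [mul_sub, ← hg3, hgz, ← hh.1.2, hh.2.1, sub_self]
      rw [h1, ← mul_assoc, hag, ← map_mul, h2, map_zero]
    have hc : ∀ r, (g - h) * r = r * (g - h) := fun r => by
      rw [sub_mul, mul_sub, hg3, hh.1.2 r]
    rw [← hy, ← mul_assoc, mul_assoc _ r, ← hcentral _ hc, ← mul_assoc, hz, zero_mul, zero_mul]

/-- The involution on the quotient of a *-ring by a *-closed two-sided ideal. -/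
abbrev Ideal.Quotient.starRingOfStarMem {A : Type*} [Ring A] [StarRing A] (I : Ideal A)
    [I.IsTwoSided] (hI : ∀ a ∈ I, star a ∈ I) : StarRing (A ⧸ I) where
  star := Quotient.map' star fun a b hab => by
    rw [Submodule.quotientRel_def] at hab ⊢
    rw [← star_sub]
    exact hI _ hab
  star_involutive := by
    rintro ⟨a⟩
    exact congrArg (Ideal.Quotient.mk I) (star_star a)
  star_mul := by
    rintro ⟨a⟩ ⟨b⟩
    exact congrArg (Ideal.Quotient.mk I) (star_mul a b)
  star_add := by
    rintro ⟨a⟩ ⟨b⟩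
    exact congrArg (Ideal.Quotient.mk I) (star_add a b)

namespace Unitization

variable (R K : Type*) [NonUnitalRing R] [CommRing K] [Module K R]

variable {R K} in
lemma exists_mul_inr_eq_inr (a : Unitization K R) (r : R) :
    ∃ t : R, a * (r : Unitization K R) = t :=
  ⟨a.fst • r + a.snd * r, by ext <;> simp⟩

variable [IsScalarTower K R R] [SMulCommClass K R R]

/-- The left annihilator of `R` in its unitization. -/
def annihilatorInr : Ideal (Unitization K R) where
  carrier := {a | ∀ r : R, a * (r : Unitization K R) = 0}
  add_mem' ha hb r := by rw [add_mul, ha r, hb r, add_zero]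
  zero_mem' r := zero_mul _
  smul_mem' c a ha r := by rw [smul_eq_mul, mul_assoc, ha r, mul_zero]

instance : (annihilatorInr R K).IsTwoSided where
  mul_mem_of_left b ha r := by
    obtain ⟨t, ht⟩ := exists_mul_inr_eq_inr b r
    rw [mul_assoc, ht, ha t]

variable {R K} in
lemma star_mem_annihilatorInr [StarRing R] [StarRing K] [StarModule K R]
    (hR : ∀ t : R, (∀ r : R, t * r = 0) → t = 0) (a : Unitization K R)
    (ha : a ∈ annihilatorInr R K) : star a ∈ annihilatorInr R K := by
  intro r
  obtain ⟨t, ht⟩ := exists_mul_inr_eq_inr (star a) r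
  suffices star t = 0 by rw [ht, ← star_star t, this, star_zero, inr_zero]
  refine hR _ fun s => inr_injective (R := K) ?_
  have h : (star t : R) = star (r : Unitization K R) * a := by
    rw [inr_star, ← ht, star_mul, star_star]
  rw [inr_mul, h, mul_assoc, ha s, mul_zero, inr_zero]

end Unitization

/-- Main theorem for Problem 2: a weakly p.q.-Baer *-ring `R` which is a *-algebra over a
commutative *-ring `K` with unity satisfying condition (β) can be embedded in a p.q.-Baer *-ring
with preservation of central covers. -/
theorem weakly_pqBaer_embeds_of_condition_beta {R : Type u} {K : Type v}
    [NonUnitalRing R] [StarRing R] [CommRing K] [StarRing K]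
    [Module K R] [IsScalarTower K R R] [SMulCommClass K R R] [StarModule K R]
    (hw : ∀ x : R, ∃ e : R, IsCentralCover e x ∧
      ∀ y : R, (∀ r : R, x * r * y = 0) ↔ e * y = 0)
    (hβ : ∀ l : K, l ≠ 0 → ∃ el : R, (star el = el ∧ el * el = el) ∧
      ∀ x : R, l • x = 0 → ∀ c : R, IsCentralCover c x → c * el = c) :
    ∃ (S : Type (max u v)) (_ : NonUnitalRing S) (_ : StarRing S),
      (∀ a : S, ∃ e : S, (star e = e ∧ e * e = e) ∧
        ∀ y : S, (∀ r : S, a * r * y = 0) ↔ e * y = y) ∧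
      ∃ φ : R → S, Function.Injective φ ∧
        (∀ x y : R, φ (x + y) = φ x + φ y) ∧
        (∀ x y : R, φ (x * y) = φ x * φ y) ∧
        (∀ x : R, φ (star x) = star (φ x)) ∧
        (∀ a e : R, IsCentralCover e a →
          (((star (φ e) = φ e ∧ φ e * φ e = φ e) ∧ (∀ r : S, φ e * r = r * φ e)) ∧
            φ e * φ a = φ a ∧
            ∀ h : S, ((star h = h ∧ h * h = h) ∧ (∀ r : S, h * r = r * h)) →
              h * φ a = φ a → φ e * h = φ e)) := by
  have hR : ∀ t : R, (∀ r : R, t * r = 0) → t = 0 := fun t => eq_zero_of_forall_mul_eq_zero' hw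
  let I := Unitization.annihilatorInr R K
  let _ : StarRing (Unitization K R ⧸ I) :=
    Ideal.Quotient.starRingOfStarMem I (Unitization.star_mem_annihilatorInr hR)
  let π : Unitization K R →+* Unitization K R ⧸ I := Ideal.Quotient.mk I
  have hπ : Function.Surjective π := Ideal.Quotient.mk_surjective
  have hπ0 : ∀ a, π a = 0 ↔ a ∈ I := fun a => Ideal.Quotient.eq_zero_iff_mem
  let φ : R →⋆ₙ+* Unitization K R ⧸ I :=
    { toFun := fun x => π x
      map_mul' := fun x y => by rw [Unitization.inr_mul, map_mul]
      map_zero' := by rw [Unitization.inr_zero, map_zero]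
      map_add' := fun x y => by rw [Unitization.inr_add, map_add]
      map_star' := fun x => congrArg π (Unitization.inr_star x) }
  let k : K →+* Unitization K R ⧸ I := π.comp (Unitization.inlRingHom K R)
  have hφπ : ∀ x : R, φ x = π x := fun _ => rfl
  have hφ0 : ∀ x, φ x = 0 → x = 0 := fun x hx => hR x fun r =>
    Unitization.inr_injective (R := K) (by
      rw [Unitization.inr_mul, Unitization.inr_zero]
      exact (hπ0 _).1 hx r)
  have hφ : Function.Injective φ := (injective_iff_map_eq_zero φ).2 hφ0
  have hk : ∀ l x, k l * φ x = φ (l • x) := fun l x =>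
    (map_mul π _ _).symm.trans (congrArg π (Unitization.inl_mul_inr l x))
  have hk' : ∀ l x, φ x * k l = φ (l • x) := fun l x =>
    (map_mul π _ _).symm.trans (congrArg π (Unitization.inr_mul_inl l x))
  have hsurj : ∀ a, ∃ x l, a = φ x + k l := fun a => by
    obtain ⟨b, rfl⟩ := hπ a
    refine ⟨b.snd, b.fst, ?_⟩
    conv_lhs => rw [← Unitization.inl_fst_add_inr_snd_eq b, map_add, add_comm]
    rfl
  have hideal : ∀ y (s : R), ∃ t, y * φ s = φ t := fun y s => by
    obtain ⟨x, l, rfl⟩ := hsurj y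
    exact ⟨x * s + l • s, by rw [add_mul, hk, map_add, map_mul]⟩
  have hfaith : ∀ y, (∀ s, y * φ s = 0) → y = 0 := fun y hy => by
    obtain ⟨b, rfl⟩ := hπ y
    refine (hπ0 b).2 fun r => ?_
    obtain ⟨t, ht⟩ := Unitization.exists_mul_inr_eq_inr b r
    have h := hy r
    rw [hφπ, ← map_mul, ht] at h
    rw [ht, hφ0 t h, Unitization.inr_zero]
  have hcentral : ∀ e : R, (∀ r, e * r = r * e) → ∀ s, φ e * s = s * φ e := fun e he s => by
    obtain ⟨x, l, rfl⟩ := hsurj s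
    rw [mul_add, add_mul, hk, hk', ← map_mul, ← map_mul, he]
  have hcover : ∀ x e : R, IsCentralCover e x → ∀ y,
      (∀ r, φ x * φ r * y = 0) → φ e * y = 0 := fun x e he y hy => hfaith _ fun s => by
    obtain ⟨e', he', hann⟩ := hw x
    obtain ⟨t, ht⟩ := hideal y s
    rw [mul_assoc, ht, ← map_mul, he.unique he', (hann t).1, map_zero]
    refine fun r => hφ0 _ ?_
    rw [map_mul, map_mul, ← ht, ← mul_assoc, hy, zero_mul]
  refine ⟨Unitization K R ⧸ I, inferInstance, inferInstance, fun a => ?_, φ, hφ, map_add φ,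
    map_mul φ, map_star φ, fun a e he => ⟨⟨⟨?_, ?_⟩, hcentral e he.1.2⟩, ?_, fun h hh hha => ?_⟩⟩
  · obtain ⟨x, l, rfl⟩ := hsurj a
    exact exists_projection_annihilator hw hβ φ k hφ hk hideal hfaith hcentral hcover x l
  · rw [← map_star, he.1.1.1]
  · rw [← map_mul, he.1.1.2]
  · rw [← map_mul, he.2.1]
  · have h0 : φ e * (h - 1) = 0 := hcover a e he _ fun r => by
      rw [mul_sub, mul_one, ← hh.2, ← mul_assoc, hha, sub_self]
    rwa [mul_sub, mul_one, sub_eq_zero] at h0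
end
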